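/- For every vertex x ≠ 0 of the tree, the mean hitting time of x starting from its parent p(x) is E[T^{p(x)}_x] = (1 − π(B_x)) / (μ_x·π(x)). -/

import Mathlib

open MeasureTheory ProbabilityTheory Filter Topology ENNReal

noncomputable section

/-- A discrete-time birth-and-death chain on a countable rooted tree `I`.
The tree is encoded by a root, a parent map and a depth function; the chain is
encoded by its transition matrix `P` (nonzero only between tree-neighbours and
on the diagonal) and by the laws `law x` of the trajectories started at `x`,
characterised by the cylinder formula.  `invm` is the reversible invariant
probability measure of the chain (positive recurrence). -/
structure TreeChain (I : Type*) [MeasurableSpace I] where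
  root : I
  par : I → I
  depth : I → ℕ
  par_root : par root = root
  depth_root : depth root = 0
  depth_eq_zero : ∀ x, depth x = 0 → x = root
  depth_par : ∀ x, x ≠ root → depth x = depth (par x) + 1
  P : I → I → ℝ≥0∞
  P_row : ∀ x, ∑' y, P x y = 1
  P_support : ∀ x y, P x y ≠ 0 → y = x ∨ y = par x ∨ x = par y
  lam_pos : ∀ x, x ≠ root → P (par x) x ≠ 0
  mu_pos : ∀ x, x ≠ root → P x (par x) ≠ 0
  law : I → Measure (ℕ → I)
  law_prob : ∀ x, IsProbabilityMeasure (law x)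
  law_start : ∀ x, law x {ω | ω 0 = x} = 1
  law_cyl : ∀ x (n : ℕ) (γ : ℕ → I), γ 0 = x →
    law x {ω | ∀ i ≤ n, ω i = γ i} = ∏ i ∈ Finset.range n, P (γ i) (γ (i + 1))
  invm : I → ℝ≥0∞
  invm_pos : ∀ x, invm x ≠ 0
  invm_sum : ∑' x, invm x = 1
  invm_rev : ∀ x y, invm x * P x y = invm y * P y x

/-- The hitting time of `y`, as an extended nonnegative real (`∞` if `y` is never hit). -/
def hitTime {I : Type*} (y : I) (ω : ℕ → I) : ℝ≥0∞ :=
  ⨅ (t : ℕ) (_ : ω t = y), (t : ℝ≥0∞)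

namespace TreeChain

variable {I : Type*} [MeasurableSpace I] (c : TreeChain I)

/-- The branch `B_x` stemming from `x`: the set of descendants of `x` (including `x`). -/
def branch (x : I) : Set I := {y | ∃ n, c.par^[n] y = x}

/-- The set `ℓ(x)` of vertices on the path from `x` to the root, the root excluded. -/
def pathToRoot (x : I) : Set I := {y | ∃ i < c.depth x, c.par^[i] x = y}

/-- The set `σ(x)` of children of `x`. -/
def children (x : I) : Set I := {y | y ≠ c.root ∧ c.par y = x}

/-- `μ_x`, the transition probability from `x` to its parent. -/
def mu (x : I) : ℝ≥0∞ := c.P x (c.par x)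

/-- `λ_x`, the transition probability from the parent of `x` to `x`. -/
def lamP (x : I) : ℝ≥0∞ := c.P (c.par x) x

/-- `π(A)`, the invariant mass of a set of vertices. -/
def piSet (A : Set I) : ℝ≥0∞ := ∑' y : A, c.invm (y : I)

/-- `E[T^x_y]`, the expected hitting time of `y` for the chain started at `x`. -/
def ET (x y : I) : ℝ≥0∞ := ∫⁻ ω, hitTime y ω ∂(c.law x)

/-- `E[(T^x_y)²]`, the second moment of the hitting time of `y` started at `x`. -/
def ET2 (x y : I) : ℝ≥0∞ := ∫⁻ ω, (hitTime y ω) ^ 2 ∂(c.law x)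

/-- The normalised hitting time `T^x_y / E[T^x_y]` as a real random variable. -/
def ratio (x y : I) (ω : ℕ → I) : ℝ := (hitTime y ω).toReal / (c.ET x y).toReal

/-- `α(a)`: the child of the root lying on the path from `a` to the root. -/
def alphaVert (a : I) : I := c.par^[c.depth a - 1] a

/-- The drift constant `K_a = sup_{b ∈ B_{α(a)}} μ_b · E[T^b_{p(b)}]`. -/
def Kdrift (a : I) : ℝ≥0∞ :=
  ⨆ b ∈ c.branch (c.alphaVert a), c.mu b * c.ET b (c.par b)

/-- The global constant `K'_a = sup_{b ∈ I} μ_b · E[T^b_{p(b)}]`. -/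
def Kdrift' : ℝ≥0∞ := ⨆ b : I, c.mu b * c.ET b (c.par b)

/-- The quantity `Q_x = π(B_x)⁻¹ · Σ_{b ∈ B_x} π(B_b)²/(μ_b π(b))`. -/
def Qx (x : I) : ℝ≥0∞ :=
  (c.piSet (c.branch x))⁻¹ *
    ∑' b : c.branch x, (c.piSet (c.branch (b : I))) ^ 2 / (c.mu (b : I) * c.invm (b : I))

/-- `Q_a = sup_{x ∈ ℓ(a)} Q_x`. -/
def Qsup (a : I) : ℝ≥0∞ := ⨆ x ∈ c.pathToRoot a, c.Qx x

/-- `R_a = Σ_{b ∈ ℓ(a)} π(B_b)²/(μ_b π(b))`. -/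
def Rsum (a : I) : ℝ≥0∞ :=
  ∑' b : c.pathToRoot a, (c.piSet (c.branch (b : I))) ^ 2 / (c.mu (b : I) * c.invm (b : I))

/-- The set `C_{a,k}`: union over the vertices `a_l`, `k < l ≤ d(a)`, of the path from
`a_k` to the root, of the branches stemming from the children of `a_l` other
than `a_{l-1}`. -/
def Cset (a : I) (k : ℕ) : Set I :=
  {y | ∃ l, k + 1 ≤ l ∧ l ≤ c.depth a ∧
    ∃ ch, ch ∈ c.children (c.par^[l] a) ∧ ch ≠ c.par^[l - 1] a ∧ y ∈ c.branch ch}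

end TreeChain

/-- The strong drift condition `0^ℓ-SD` toward the root, for a family of chains
`c n` with distinguished vertices `a n` (the limit `a → ∞` being `n → ∞`). -/
def StrongDrift {I : ℕ → Type*} [∀ n, MeasurableSpace (I n)]
    (c : ∀ n, TreeChain (I n)) (a : ∀ n, I n) : Prop :=
  (∃ Kmu : ℝ≥0∞, 0 < Kmu ∧
      ∀ n, ∀ b ∈ (c n).branch ((c n).alphaVert (a n)), Kmu ≤ (c n).mu b) ∧
  Tendsto (fun n => ((c n).Kdrift (a n)) ^ 2 / (c n).ET (a n) (c n).root) atTop (𝓝 0)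


namespace TreeChain

variable {I : Type*} [MeasurableSpace I] (c : TreeChain I)

theorem exists_P_ne_zero {x : I} (hx : x ≠ c.root) (b : I) : ∃ y, c.P y b ≠ 0 := by
  by_cases hb : b = c.root
  · have key : ∀ n y, c.depth y = n → y ≠ c.root → ∃ z, z ≠ c.root ∧ c.par z = c.root := by
      intro n
      induction n with
      | zero => exact fun y hy hne => absurd (c.depth_eq_zero y hy) hne
      | succ n ih =>
        intro y hy hne
        by_cases h : c.par y = c.root
        · exact ⟨y, hne, h⟩
        · exact ih _ (by have := c.depth_par y hne; omega) h
    obtain ⟨z, hz, hz'⟩ := key _ x rfl hx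
    exact ⟨z, by rw [hb, ← hz']; exact c.mu_pos z hz⟩
  · exact ⟨c.par b, c.lam_pos b hb⟩

/-- The probability that the first step from `y` leads to `z`, as an outer measure. -/
theorem law_first_step (y z : I) : c.law y {ω | ω 0 = y ∧ ω 1 = z} = c.P y z := by
  have h := c.law_cyl y 1 (fun i => if i = 0 then y else z) (by simp)
  rw [Finset.prod_range_one] at h
  have hset : {ω : ℕ → I | ∀ i ≤ 1, ω i = if i = 0 then y else z} =
      {ω | ω 0 = y ∧ ω 1 = z} := by
    ext ω
    constructor
    · intro h
      exact ⟨by simpa using h 0 (by omega), by simpa using h 1 le_rfl⟩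
    · rintro ⟨h0, h1⟩ i hi
      interval_cases i
      · simpa using h0
      · simpa using h1
  simpa [hset] using h

theorem P_eq_zero_of_inseparable [Countable I] {a b : I} (hab : a ≠ b)
    (h : ∀ S : Set I, MeasurableSet S → a ∈ S → b ∈ S) (y : I) : c.P y b = 0 := by
  let cyl : I → Set (ℕ → I) := fun z => {ω | ω 0 = y ∧ ω 1 = z}
  let M : I → Set (ℕ → I) := fun z => toMeasurable (c.law y) (cyl z)
  have hb : cyl b ⊆ M a := by
    rintro ω ⟨h0, h1⟩
    have hm : Measurable fun i : I => Function.update ω 1 i := measurable_update ω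
    have hS := h _ (hm (measurableSet_toMeasurable (c.law y) (cyl a)))
      (subset_toMeasurable (c.law y) (cyl a) ⟨by simpa using h0, by simp⟩)
    have hω : Function.update ω 1 b = ω := by rw [← h1]; simp
    simpa [hω] using hS
  have hcover : {ω : ℕ → I | ω 0 = y} ⊆ ⋃ z : ({b}ᶜ : Set I), M z := by
    intro ω hω
    by_cases hz : ω 1 = b
    · exact Set.mem_iUnion.2 ⟨⟨a, hab⟩, hb ⟨hω, hz⟩⟩
    · exact Set.mem_iUnion.2 ⟨⟨ω 1, hz⟩, subset_toMeasurable (c.law y) _ ⟨hω, rfl⟩⟩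
  have hle : 1 ≤ ∑' z : ({b}ᶜ : Set I), c.P y z := by
    calc 1 = c.law y {ω | ω 0 = y} := (c.law_start y).symm
      _ ≤ c.law y (⋃ z : ({b}ᶜ : Set I), M z) := measure_mono hcover
      _ ≤ ∑' z : ({b}ᶜ : Set I), c.law y (M z) := measure_iUnion_le _
      _ = ∑' z : ({b}ᶜ : Set I), c.P y z := by
        simp only [M, measure_toMeasurable, cyl, law_first_step]
  have hsum := ENNReal.summable.tsum_add_tsum_compl (f := c.P y) (s := {b}) ENNReal.summable
  rw [c.P_row, tsum_singleton] at hsum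
  have h1 : c.P y b + 1 ≤ 0 + 1 := by
    calc c.P y b + 1 ≤ 1 := (add_le_add_right hle _).trans_eq hsum
      _ = 0 + 1 := (zero_add 1).symm
  simpa using (ENNReal.add_le_add_iff_right ENNReal.one_ne_top).1 h1

/-- The cylinder formula forces the measurable structure of a nontrivial chain to be discrete. -/
theorem measurableSingletonClass [Countable I] {x : I} (hx : x ≠ c.root) :
    MeasurableSingletonClass I := by
  have hsep : ∀ a b : I, ∃ S : Set I, MeasurableSet S ∧ a ∈ S ∧ (b ≠ a → b ∉ S) := by
    intro a b
    by_contra! hcon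
    obtain ⟨hne, -⟩ := hcon Set.univ MeasurableSet.univ trivial
    obtain ⟨y, hy⟩ := c.exists_P_ne_zero hx b
    exact hy (c.P_eq_zero_of_inseparable hne.symm (fun S hS ha => (hcon S hS ha).2) y)
  refine ⟨fun a => ?_⟩
  choose S hS ha hb using hsep a
  have : {a} = ⋂ b, S b := by
    ext b
    simp only [Set.mem_singleton_iff, Set.mem_iInter]
    refine ⟨fun h i => h ▸ ha i, fun h => ?_⟩
    by_contra hne
    exact hb b hne (h b)
  rw [this]
  exact MeasurableSet.iInter hS

theorem measurableSet_apply_eq {I : Type*} [MeasurableSpace I] [MeasurableSingletonClass I]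
    (i : ℕ) (a : I) : MeasurableSet {ω : ℕ → I | ω i = a} :=
  (measurableSet_singleton a).preimage (measurable_pi_apply i)

open Classical in
/-- The probability that the chain started at `y` avoids `x` up to time `n`. -/
def survival (x : I) : ℕ → I → ℝ≥0∞
  | 0, y => if y = x then 0 else 1
  | n + 1, y => if y = x then 0 else ∑' z, c.P y z * survival x n z

theorem survival_self (x : I) (n : ℕ) : c.survival x n x = 0 := by
  cases n <;> simp [survival]

theorem survival_succ {x y : I} (h : y ≠ x) (n : ℕ) :
    c.survival x (n + 1) y = ∑' z, c.P y z * c.survival x n z := by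
  simp [survival, h]

theorem survival_le_one (x : I) (n : ℕ) (y : I) : c.survival x n y ≤ 1 := by
  induction n generalizing y with
  | zero => simp only [survival]; split_ifs <;> simp
  | succ n ih =>
    simp only [survival]
    split_ifs
    · simp
    · calc ∑' z, c.P y z * c.survival x n z ≤ ∑' z, c.P y z :=
          ENNReal.tsum_le_tsum fun z => mul_le_of_le_one_right' (ih z)
        _ = 1 := c.P_row y

theorem law_cylinder_inter_avoid [Countable I] [MeasurableSingletonClass I] (x : I) (n : ℕ) :
    ∀ (m : ℕ) (γ : ℕ → I),
      c.law (γ 0) {ω | (∀ i ≤ m, ω i = γ i) ∧ ∀ j ≤ n, ω (m + j) ≠ x} =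
        (∏ i ∈ Finset.range m, c.P (γ i) (γ (i + 1))) * c.survival x n (γ m) := by
  induction n with
  | zero =>
    intro m γ
    by_cases h : γ m = x
    · rw [h, survival_self, mul_zero]
      convert measure_empty (μ := c.law (γ 0))
      ext ω
      simp only [Set.mem_ofPred_eq, Set.mem_empty_iff_false, iff_false, not_and]
      intro h1 h2
      exact h2 0 le_rfl ((h1 m le_rfl).trans h)
    · rw [← c.law_cyl (γ 0) m γ rfl]
      simp only [survival, if_neg h, mul_one]
      congr 1
      ext ω
      refine ⟨fun h1 => h1.1, fun h1 => ⟨h1, fun j hj => ?_⟩⟩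
      obtain rfl : j = 0 := by omega
      exact fun h2 => h ((h1 m le_rfl).symm.trans h2)
  | succ n ih =>
    intro m γ
    by_cases h : γ m = x
    · rw [h, survival_self, mul_zero]
      convert measure_empty (μ := c.law (γ 0))
      ext ω
      simp only [Set.mem_ofPred_eq, Set.mem_empty_iff_false, iff_false, not_and]
      intro h1 h2
      exact h2 0 (Nat.zero_le _) ((h1 m le_rfl).trans h)
    · let δ : I → ℕ → I := fun z => Function.update γ (m + 1) z
      have hδ : ∀ z, ∀ i ≤ m, δ z i = γ i := fun z i hi =>
        Function.update_of_ne (by omega) _ _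
      have hδ' : ∀ z, δ z (m + 1) = z := fun z => Function.update_self _ _ _
      let E : I → Set (ℕ → I) := fun z =>
        {ω | (∀ i ≤ m + 1, ω i = δ z i) ∧ ∀ j ≤ n, ω (m + 1 + j) ≠ x}
      have hunion : {ω : ℕ → I | (∀ i ≤ m, ω i = γ i) ∧ ∀ j ≤ n + 1, ω (m + j) ≠ x} =
          ⋃ z, E z := by
        ext ω
        simp only [Set.mem_iUnion, E, Set.mem_ofPred_eq]
        constructor
        · rintro ⟨h1, h2⟩
          refine ⟨ω (m + 1), fun i hi => ?_, fun j hj => ?_⟩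
          · rcases Nat.lt_or_ge m i with hi' | hi'
            · obtain rfl : i = m + 1 := by omega
              exact (hδ' _).symm
            · rw [hδ _ i hi', h1 i hi']
          · have := h2 (j + 1) (by omega)
            rwa [← add_assoc, add_right_comm] at this
        · rintro ⟨z, h1, h2⟩
          have h3 : ∀ i ≤ m, ω i = γ i := fun i hi => (h1 i (by omega)).trans (hδ z i hi)
          refine ⟨h3, fun j hj => ?_⟩
          rcases j with _ | j
          · exact fun h4 => h ((h3 m le_rfl).symm.trans h4)
          · have := h2 j (by omega)
            rwa [add_right_comm, add_assoc] at this
      have hdisj : Pairwise (Function.onFun Disjoint E) := by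
        intro z w hzw
        refine Set.disjoint_left.2 fun ω h1 h2 => hzw ?_
        rw [← hδ' z, ← hδ' w, ← h1.1 _ le_rfl, ← h2.1 _ le_rfl]
      have hmeas : ∀ z, MeasurableSet (E z) := by
        intro z
        have h1 : MeasurableSet {ω : ℕ → I | ∀ i ≤ m + 1, ω i = δ z i} := by
          simp only [Set.ofPred_forall]
          exact .iInter fun i => .iInter fun _ => measurableSet_apply_eq i _
        have h2 : MeasurableSet {ω : ℕ → I | ∀ j ≤ n, ω (m + 1 + j) ≠ x} := by
          simp only [Set.ofPred_forall]
          exact .iInter fun j => .iInter fun _ => (measurableSet_apply_eq _ x).compl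
        exact h1.inter h2
      rw [hunion, measure_iUnion hdisj hmeas, survival_succ _ h, ← ENNReal.tsum_mul_left]
      refine tsum_congr fun z => ?_
      have h0 := ih (m + 1) (δ z)
      rw [hδ z 0 (Nat.zero_le _), hδ', Finset.prod_range_succ, hδ', hδ z m le_rfl] at h0
      rw [show c.law (γ 0) (E z) = _ from h0, mul_assoc]
      congr 1
      refine Finset.prod_congr rfl fun i hi => ?_
      have hi := Finset.mem_range.1 hi
      rw [hδ z i hi.le, hδ z (i + 1) hi]

theorem law_avoid [Countable I] [MeasurableSingletonClass I] (x y : I) (n : ℕ) :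
    c.law y {ω | ∀ j ≤ n, ω j ≠ x} = c.survival x n y := by
  have h := c.law_cylinder_inter_avoid x n 0 (fun _ => y)
  simp only [Finset.range_zero, Finset.prod_empty, one_mul, zero_add] at h
  rw [← h]
  have := c.law_prob y
  have hstart : ∀ᵐ ω ∂c.law y, ω 0 = y :=
    (prob_compl_eq_zero_iff (measurableSet_apply_eq 0 y)).2
      (c.law_start y)
  refine measure_congr ?_
  filter_upwards [hstart] with ω hω
  refine propext ⟨fun h1 => ⟨fun i hi => ?_, h1⟩, fun h1 => h1.2⟩
  obtain rfl : i = 0 := by omega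
  exact hω

end TreeChain

theorem hitTime_eq_tsum {I : Type*} (x : I) (ω : ℕ → I) :
    hitTime x ω = ∑' n, {ω : ℕ → I | ∀ j ≤ n, ω j ≠ x}.indicator 1 ω := by
  classical
  by_cases h : ∃ t, ω t = x
  · have hlt : ∀ n, (∀ j ≤ n, ω j ≠ x) ↔ n < Nat.find h := fun n => (Nat.lt_find_iff h n).symm
    have hhit : hitTime x ω = Nat.find h := by
      refine le_antisymm (iInf₂_le (f := fun (t : ℕ) (_ : ω t = x) => (t : ℝ≥0∞)) _ (Nat.find_spec h)) (le_iInf₂ fun t ht => ?_)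
      exact_mod_cast Nat.find_min' h ht
    rw [hhit, tsum_eq_sum (s := Finset.range (Nat.find h))]
    · rw [Finset.sum_congr rfl (g := fun _ => (1 : ℝ≥0∞))]
      · simp
      · intro n hn
        exact Set.indicator_of_mem
          (show ω ∈ {ω | ∀ j ≤ n, ω j ≠ x} from (hlt n).2 (Finset.mem_range.1 hn)) _
    · intro n hn
      exact Set.indicator_of_notMem (s := {ω : ℕ → I | ∀ j ≤ n, ω j ≠ x})
        (fun h1 => hn (Finset.mem_range.2 ((hlt n).1 h1))) _
  · push Not at h
    have h1 : ∀ n, {ω : ℕ → I | ∀ j ≤ n, ω j ≠ x}.indicator (1 : (ℕ → I) → ℝ≥0∞) ω = 1 :=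
      fun n => Set.indicator_of_mem (s := {ω : ℕ → I | ∀ j ≤ n, ω j ≠ x}) (fun j _ => h j) _
    simp only [h1, hitTime, h, iInf_false, iInf_top]
    exact (ENNReal.tsum_const_eq_top_of_ne_zero one_ne_zero).symm

namespace TreeChain

variable {I : Type*} [MeasurableSpace I] (c : TreeChain I)

theorem ET_eq_tsum_survival [Countable I] [MeasurableSingletonClass I] (x y : I) :
    c.ET y x = ∑' n, c.survival x n y := by
  have hmeas : ∀ n, MeasurableSet {ω : ℕ → I | ∀ j ≤ n, ω j ≠ x} := by
    intro n
    simp only [Set.ofPred_forall]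
    exact .iInter fun j => .iInter fun _ => (measurableSet_apply_eq j x).compl
  simp only [ET, hitTime_eq_tsum]
  rw [lintegral_tsum fun n => (measurable_one.indicator (hmeas n)).aemeasurable]
  exact tsum_congr fun n => by rw [lintegral_indicator_one (hmeas n), law_avoid]

theorem mem_branch_of_par {x y : I} (h : c.par y ∈ c.branch x) : y ∈ c.branch x := by
  obtain ⟨n, hn⟩ := h
  exact ⟨n + 1, hn⟩

theorem mem_branch_self (x : I) : x ∈ c.branch x := ⟨0, rfl⟩

theorem eq_or_par_mem_branch {x y : I} (h : y ∈ c.branch x) : y = x ∨ c.par y ∈ c.branch x := by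
  obtain ⟨_ | n, hn⟩ := h
  · exact Or.inl hn
  · exact Or.inr ⟨n, hn⟩

theorem root_notMem_branch {x : I} (hx : x ≠ c.root) : c.root ∉ c.branch x := by
  rintro ⟨n, hn⟩
  rw [Function.iterate_fixed c.par_root] at hn
  exact hx hn.symm

theorem par_notMem_branch {x : I} (hx : x ≠ c.root) : c.par x ∉ c.branch x := by
  have hdepth : ∀ y, c.depth (c.par y) ≤ c.depth y := by
    intro y
    by_cases hy : y = c.root
    · rw [hy, c.par_root]
    · have := c.depth_par y hy
      omega
  have hiter : ∀ n y, c.depth (c.par^[n] y) ≤ c.depth y := by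
    intro n
    induction n with
    | zero => exact fun y => le_rfl
    | succ n ih => exact fun y => (ih (c.par y)).trans (hdepth y)
  rintro ⟨n, hn⟩
  have h1 := hiter n (c.par x)
  rw [hn] at h1
  have := c.depth_par x hx
  omega

/-- The mass flow of the invariant measure restricted to the complement of the branch `B_x`:
only the edge between `x` and its parent leaks. -/
theorem tsum_indicator_invm_mul_P {x : I} (hx : x ≠ c.root) {z : I} (hz : z ≠ x) :
    ∑' y, (c.branch x)ᶜ.indicator c.invm y * c.P y z +
      ({c.par x} : Set I).indicator (fun _ => c.mu x * c.invm x) z =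
        (c.branch x)ᶜ.indicator c.invm z := by
  classical
  by_cases hzB : z ∈ c.branch x
  · have h1 : z ≠ c.par x := fun h => c.par_notMem_branch hx (h ▸ hzB)
    rw [Set.indicator_of_notMem (show z ∉ ({c.par x} : Set I) from h1),
      Set.indicator_of_notMem (show z ∉ (c.branch x)ᶜ from fun h => h hzB), add_zero,
      ENNReal.tsum_eq_zero]
    intro y
    by_cases hyB : y ∈ c.branch x
    · simp [hyB]
    · suffices c.P y z = 0 by simp [this]
      by_contra hP
      rcases c.P_support y z hP with rfl | rfl | rfl
      · exact hyB hzB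
      · exact hyB (c.mem_branch_of_par hzB)
      · exact hyB ((c.eq_or_par_mem_branch hzB).resolve_left hz)
  · have hterm : ∀ y, c.invm z * c.P z y = (c.branch x)ᶜ.indicator c.invm y * c.P y z +
        ({x} : Set I).indicator (fun y => c.invm z * c.P z y) y := by
      intro y
      by_cases hyB : y ∈ c.branch x
      · rw [Set.indicator_of_notMem (show y ∉ (c.branch x)ᶜ from fun h => h hyB), zero_mul,
          zero_add]
        by_cases hyx : y = x
        · simp [hyx]
        · suffices c.P z y = 0 by
            rw [this, mul_zero, Set.indicator_of_notMem (show y ∉ ({x} : Set I) from hyx)]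
          by_contra hP
          rcases c.P_support z y hP with rfl | rfl | rfl
          · exact hzB hyB
          · exact hzB (c.mem_branch_of_par hyB)
          · exact hzB ((c.eq_or_par_mem_branch hyB).resolve_left hyx)
      · have hyx : y ≠ x := fun h => hyB (h ▸ c.mem_branch_self x)
        simp [hyB, hyx, c.invm_rev z y]
    have hleak : ({c.par x} : Set I).indicator (fun _ => c.mu x * c.invm x) z =
        c.invm z * c.P z x := by
      by_cases h : z = c.par x
      · subst h
        simp [mu, c.invm_rev (c.par x) x, mul_comm]
      · rw [Set.indicator_of_notMem (show z ∉ ({c.par x} : Set I) from h)]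
        suffices c.P z x = 0 by simp [this]
        by_contra hP
        rcases c.P_support z x hP with rfl | rfl | rfl
        · exact hz rfl
        · exact hzB (c.mem_branch_of_par (c.mem_branch_self _))
        · exact h rfl
    have hsum : ∑' y, c.invm z * c.P z y = c.invm z := by
      rw [ENNReal.tsum_mul_left, c.P_row, mul_one]
    have hsingle : ∑' y, ({x} : Set I).indicator (fun y => c.invm z * c.P z y) y =
        c.invm z * c.P z x := by
      rw [tsum_eq_single x fun y hy => Set.indicator_of_notMem (by simpa using hy) _]
      simp
    rw [Set.indicator_of_mem (show z ∈ (c.branch x)ᶜ from hzB), hleak, ← hsingle,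
      ← ENNReal.tsum_add, ← hsum]
    exact tsum_congr fun y => by rw [hsum]; exact (hterm y).symm

/-- The stationary mass of the trajectories that start outside `B_x` and avoid `x` up to time
`n`. -/
def survivalMass (x : I) (n : ℕ) : ℝ≥0∞ :=
  ∑' y, (c.branch x)ᶜ.indicator c.invm y * c.survival x n y

theorem survivalMass_zero (x : I) : c.survivalMass x 0 = 1 - c.piSet (c.branch x) := by
  have hsum := ENNReal.summable.tsum_add_tsum_compl (f := c.invm) (s := c.branch x)
    ENNReal.summable
  rw [c.invm_sum] at hsum
  have hmass : c.survivalMass x 0 = ∑' y : ((c.branch x)ᶜ : Set I), c.invm y := by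
    rw [tsum_subtype, survivalMass]
    refine tsum_congr fun y => ?_
    by_cases hy : y ∈ c.branch x
    · simp [hy]
    · have hyx : y ≠ x := fun h => hy (h ▸ c.mem_branch_self x)
      simp [survival, hyx]
  rw [hmass]
  refine ENNReal.eq_sub_of_add_eq ?_ (by rw [add_comm]; exact hsum)
  exact ((le_self_add.trans hsum.le).trans_lt ENNReal.one_lt_top).ne

theorem survivalMass_succ {x : I} (hx : x ≠ c.root) (n : ℕ) :
    c.survivalMass x (n + 1) + c.mu x * c.invm x * c.survival x n (c.par x) =
      c.survivalMass x n := by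
  have h1 : c.survivalMass x (n + 1) =
      ∑' z, (∑' y, (c.branch x)ᶜ.indicator c.invm y * c.P y z) * c.survival x n z := by
    simp only [← ENNReal.tsum_mul_right]
    rw [ENNReal.tsum_comm]
    refine tsum_congr fun y => ?_
    by_cases hy : y ∈ c.branch x
    · simp [hy]
    · have hyx : y ≠ x := fun h => hy (h ▸ c.mem_branch_self x)
      simp only [c.survival_succ hyx, ← ENNReal.tsum_mul_left, mul_assoc]
  have h2 : c.mu x * c.invm x * c.survival x n (c.par x) =
      ∑' z, ({c.par x} : Set I).indicator (fun _ => c.mu x * c.invm x) z *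
        c.survival x n z := by
    rw [tsum_eq_single (c.par x)]
    · simp
    · intro z hz
      simp [hz]
  rw [h1, h2, ← ENNReal.tsum_add]
  refine tsum_congr fun z => ?_
  by_cases hz : z = x
  · simp [hz, survival_self]
  · rw [← add_mul, c.tsum_indicator_invm_mul_P hx hz]

theorem survivalMass_add_sum {x : I} (hx : x ≠ c.root) (N : ℕ) :
    c.survivalMass x N +
      ∑ n ∈ Finset.range N, c.mu x * c.invm x * c.survival x n (c.par x) =
        1 - c.piSet (c.branch x) := by
  induction N with
  | zero => simpa using c.survivalMass_zero x
  | succ N ih => rw [Finset.sum_range_succ, add_comm (∑ n ∈ _, _), ← add_assoc,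
      c.survivalMass_succ hx, ih]

theorem P_ne_top (y z : I) : c.P y z ≠ ∞ :=
  (((ENNReal.le_tsum z).trans (c.P_row y).le).trans_lt ENNReal.one_lt_top).ne

theorem invm_ne_top (y : I) : c.invm y ≠ ∞ :=
  (((ENNReal.le_tsum y).trans c.invm_sum.le).trans_lt ENNReal.one_lt_top).ne

theorem tendsto_survival_of_step {x y z : I} (hy : y ≠ x) (hP : c.P y z ≠ 0)
    (h : Tendsto (fun n => c.survival x n y) atTop (𝓝 0)) :
    Tendsto (fun n => c.survival x n z) atTop (𝓝 0) := by
  have h1 : Tendsto (fun n => (c.P y z)⁻¹ * c.survival x (n + 1) y) atTop (𝓝 0) := by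
    simpa using ENNReal.Tendsto.const_mul ((tendsto_add_atTop_iff_nat 1).2 h)
      (Or.inr (ENNReal.inv_ne_top.2 hP))
  refine tendsto_of_tendsto_of_tendsto_of_le_of_le tendsto_const_nhds h1 (fun _ => zero_le)
    fun n => ?_
  calc c.survival x n z = (c.P y z)⁻¹ * (c.P y z * c.survival x n z) := by
        rw [← mul_assoc, ENNReal.inv_mul_cancel hP (c.P_ne_top y z), one_mul]
    _ ≤ (c.P y z)⁻¹ * c.survival x (n + 1) y := by
        rw [c.survival_succ hy]
        gcongr
        exact ENNReal.le_tsum (f := fun z => c.P y z * c.survival x n z) z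

theorem tendsto_survival {x : I} (hx : x ≠ c.root) {y : I} (hy : y ∉ c.branch x) :
    Tendsto (fun n => c.survival x n y) atTop (𝓝 0) := by
  have hne : ∀ {z}, z ∉ c.branch x → z ≠ x := fun hz h => hz (h ▸ c.mem_branch_self x)
  have hc0 : c.mu x * c.invm x ≠ 0 := mul_ne_zero (c.mu_pos x hx) (c.invm_pos x)
  have hct : c.mu x * c.invm x ≠ ∞ := ENNReal.mul_ne_top (c.P_ne_top _ _) (c.invm_ne_top x)
  have hpar : Tendsto (fun n => c.survival x n (c.par x)) atTop (𝓝 0) := by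
    refine ENNReal.tendsto_atTop_zero_of_tsum_ne_top ?_
    have hle : c.mu x * c.invm x * ∑' n, c.survival x n (c.par x) ≤ 1 := by
      rw [← ENNReal.tsum_mul_left, ENNReal.tsum_eq_iSup_nat]
      refine iSup_le fun N => ?_
      exact (le_add_self.trans (c.survivalMass_add_sum hx N).le).trans tsub_le_self
    intro htop
    rw [htop, ENNReal.mul_top hc0] at hle
    exact absurd hle (by simp)
  have hup : ∀ n z, c.depth z = n → z ∉ c.branch x →
      Tendsto (fun n => c.survival x n z) atTop (𝓝 0) →
      Tendsto (fun n => c.survival x n c.root) atTop (𝓝 0) := by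
    intro n
    induction n with
    | zero => exact fun z hz _ h => c.depth_eq_zero z hz ▸ h
    | succ n ih =>
      intro z hz hzB h
      have hzr : z ≠ c.root := by
        rintro rfl
        simp [c.depth_root] at hz
      refine ih (c.par z) (by have := c.depth_par z hzr; omega)
        (fun h => hzB (c.mem_branch_of_par h)) ?_
      exact c.tendsto_survival_of_step (hne hzB) (c.mu_pos z hzr) h
  have hroot := hup _ _ rfl (c.par_notMem_branch hx) hpar
  have hdown : ∀ n z, c.depth z = n → z ∉ c.branch x →
      Tendsto (fun n => c.survival x n z) atTop (𝓝 0) := by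
    intro n
    induction n with
    | zero => exact fun z hz _ => c.depth_eq_zero z hz ▸ hroot
    | succ n ih =>
      intro z hz hzB
      have hzr : z ≠ c.root := by
        rintro rfl
        simp [c.depth_root] at hz
      have hpB : c.par z ∉ c.branch x := fun h => hzB (c.mem_branch_of_par h)
      exact c.tendsto_survival_of_step (hne hpB) (c.lam_pos z hzr)
        (ih _ (by have := c.depth_par z hzr; omega) hpB)
  exact hdown _ y rfl hy

theorem tendsto_survivalMass [Countable I] [MeasurableSingletonClass I] {x : I}
    (hx : x ≠ c.root) : Tendsto (c.survivalMass x) atTop (𝓝 0) := by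
  have h := tendsto_lintegral_of_dominated_convergence (μ := Measure.count)
    (F := fun n y => (c.branch x)ᶜ.indicator c.invm y * c.survival x n y) (f := fun _ => 0)
    c.invm (fun n => Measurable.of_discrete)
    (fun n => .of_forall fun y => (mul_le_of_le_one_right' (c.survival_le_one x n y)).trans
      (Set.indicator_le_self _ _ y))
    (by simp [lintegral_count, c.invm_sum])
    (.of_forall fun y => by
      by_cases hy : y ∈ c.branch x
      · simp [hy]
      · simpa [hy] using ENNReal.Tendsto.const_mul (c.tendsto_survival hx hy)
          (Or.inr (c.invm_ne_top y)))
  simp only [lintegral_count, tsum_zero] at h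
  exact h

end TreeChain

/-- **Lemma (3.2), first moment parent → child**:
`E[T^{p(x)}_x] = (1 − π(B_x))/(μ_x·π(x))`. -/
theorem ET_parent_child {I : Type*} [MeasurableSpace I] [Countable I]
    (c : TreeChain I) (x : I) (hx : x ≠ c.root) :
    c.ET (c.par x) x = (1 - c.piSet (c.branch x)) / (c.mu x * c.invm x) := by
  have := c.measurableSingletonClass hx
  have hc0 : c.mu x * c.invm x ≠ 0 := mul_ne_zero (c.mu_pos x hx) (c.invm_pos x)
  have hct : c.mu x * c.invm x ≠ ∞ := ENNReal.mul_ne_top (c.P_ne_top _ _) (c.invm_ne_top x)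
  rw [c.ET_eq_tsum_survival, ENNReal.eq_div_iff hc0 hct, ← ENNReal.tsum_mul_left]
  have h := (c.tendsto_survivalMass hx).add (ENNReal.tendsto_nat_tsum
    fun n => c.mu x * c.invm x * c.survival x n (c.par x))
  simp only [c.survivalMass_add_sum hx, zero_add] at h
  exact tendsto_nhds_unique h tendsto_const_nhds
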